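/- Let A be an arbitrary 2-index real array on n-dimensional Minkowski vector space with superenergy tensor T, and let ℓ be a null vector. Then T_{αβλμ}ℓ^α = 0 for all β,λ,μ if and only if ℓ_τA_{μν} − ℓ_μA_{τν} = 0 for all τ,μ,ν. -/

import Mathlib

open Finset

noncomputable section

/-- Sign of the `i`-th diagonal entry of the Minkowski metric diag(-1,1,...,1). -/
def sgn {n : ℕ} (i : Fin n) : ℝ := if (i : ℕ) = 0 then -1 else 1

/-- The Minkowski metric components η_{ij} (= η^{ij}). -/
def eta {n : ℕ} (i j : Fin n) : ℝ := if i = j then sgn i else 0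

/-- Minkowski square η(v,v) of a vector. -/
def mSq {n : ℕ} (v : Fin n → ℝ) : ℝ := ∑ i, sgn i * v i * v i

/-- Lowered components v_i = η_{ij} v^j. -/
def lo {n : ℕ} (v : Fin n → ℝ) (i : Fin n) : ℝ := sgn i * v i

/-- The superenergy tensor of an arbitrary 2-index array A (no symmetries assumed). -/
def SE2 {n : ℕ} (A : Fin n → Fin n → ℝ) (a b l m : Fin n) : ℝ :=
  A a l * A b m + A b l * A a m
  - eta a b * (∑ r, sgn r * A r l * A r m)
  - eta l m * (∑ r, sgn r * A a r * A b r)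
  + (1/2) * eta a b * eta l m * (∑ r, ∑ s, sgn r * sgn s * A r s * A r s)

theorem sgn_mul_self {n : ℕ} (i : Fin n) : sgn i * sgn i = 1 := by
  unfold sgn; split_ifs <;> norm_num

theorem sgn_of_ne_zero {n : ℕ} {i : Fin n} (h : (i : ℕ) ≠ 0) : sgn i = 1 := if_neg h

theorem sum_eta_mul {n : ℕ} (v : Fin n → ℝ) (b : Fin n) : ∑ a, eta a b * v a = lo v b := by
  simp [eta, lo, ite_mul]

/-- The time component of a nonzero null vector does not vanish. -/
theorem time_component_ne_zero {n : ℕ} {v : Fin n → ℝ} (hv : v ≠ 0) (hnull : mSq v = 0)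
    {o : Fin n} (ho : (o : ℕ) = 0) : v o ≠ 0 := by
  intro h0
  apply hv
  have hterm : ∀ i, sgn i * v i * v i = v i * v i := by
    intro i
    by_cases hi : (i : ℕ) = 0
    · obtain rfl : i = o := Fin.ext (by omega)
      simp [h0]
    · simp [sgn_of_ne_zero hi]
  simp only [mSq, hterm] at hnull
  rw [sum_eq_zero_iff_of_nonneg (fun i _ => mul_self_nonneg _)] at hnull
  funext i
  simpa using hnull i (mem_univ i)

/-- Lagrange-type identity for a covector annihilating a null vector. -/
theorem sum_sq_wedge_eq {n : ℕ} {v w : Fin n → ℝ} (hnull : mSq v = 0)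
    (horth : ∑ i, v i * w i = 0) {o : Fin n} (ho : (o : ℕ) = 0) :
    ∑ t, (lo v o * w t - lo v t * w o) ^ 2 = lo v o ^ 2 * ∑ t, sgn t * w t * w t := by
  have hterm : ∀ t, (lo v o * w t - lo v t * w o) ^ 2 =
      lo v o ^ 2 * (sgn t * w t * w t) - 2 * lo v o * w o * (v t * w t)
        + w o ^ 2 * (sgn t * v t * v t) := by
    intro t
    have hs := sgn_mul_self t
    have hsign : (lo v o * w t - lo v t * w o) ^ 2 =
        sgn t * (lo v o * w t - lo v t * w o) ^ 2 := by
      by_cases ht : (t : ℕ) = 0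
      · obtain rfl : t = o := Fin.ext (by omega)
        ring
      · simp [sgn_of_ne_zero ht]
    rw [hsign]
    generalize lo v o = c
    simp only [lo]
    linear_combination (-2 * c * w t * v t * w o + w o ^ 2 * sgn t * v t ^ 2) * hs
  simp only [hterm, sum_add_distrib, sum_sub_distrib, ← mul_sum]
  rw [horth, show ∑ i, sgn i * v i * v i = 0 from hnull]
  ring

/-- A covector annihilating a nonzero null vector has nonnegative Minkowski square. -/
theorem sum_sgn_mul_self_nonneg {n : ℕ} {v w : Fin n → ℝ} (hv : v ≠ 0) (hnull : mSq v = 0)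
    (horth : ∑ i, v i * w i = 0) {o : Fin n} (ho : (o : ℕ) = 0) :
    0 ≤ ∑ t, sgn t * w t * w t := by
  have hc : lo v o ≠ 0 := by
    simp [lo, sgn, ho, time_component_ne_zero hv hnull ho]
  have h : 0 ≤ ∑ t, (lo v o * w t - lo v t * w o) ^ 2 := sum_nonneg fun _ _ => sq_nonneg _
  rw [sum_sq_wedge_eq hnull horth ho] at h
  exact nonneg_of_mul_nonneg_right h (by positivity)

/-- A null covector annihilating a nonzero null vector is proportional to it. -/
theorem wedge_eq_zero_of_null {n : ℕ} {v w : Fin n → ℝ} (hv : v ≠ 0) (hnull : mSq v = 0)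
    (horth : ∑ i, v i * w i = 0) {o : Fin n} (ho : (o : ℕ) = 0)
    (hw : ∑ t, sgn t * w t * w t = 0) (t m : Fin n) :
    lo v t * w m - lo v m * w t = 0 := by
  have hc : lo v o ≠ 0 := by
    simp [lo, sgn, ho, time_component_ne_zero hv hnull ho]
  have h := sum_sq_wedge_eq hnull horth ho
  rw [hw, mul_zero, sum_eq_zero_iff_of_nonneg (fun _ _ => sq_nonneg _)] at h
  have h' : ∀ i, lo v o * w i - lo v i * w o = 0 := fun i => by simpa using h i (mem_univ i)
  apply (mul_eq_zero.mp _).resolve_left hc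
  linear_combination lo v t * h' m - lo v m * h' t

/-- The contraction of the superenergy tensor with a vector in its first slot. -/
theorem sum_SE2_mul {n : ℕ} (A : Fin n → Fin n → ℝ) (v : Fin n → ℝ) (b l m : Fin n) :
    ∑ a, SE2 A a b l m * v a =
      (∑ a, v a * A a l) * A b m + A b l * (∑ a, v a * A a m)
      - lo v b * (∑ r, sgn r * A r l * A r m)
      - eta l m * (∑ r, sgn r * (∑ a, v a * A a r) * A b r)
      + (1/2) * lo v b * eta l m * (∑ r, ∑ s, sgn r * sgn s * A r s * A r s) := by
  have hswap : ∑ r, sgn r * (∑ a, v a * A a r) * A b r =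
      ∑ a, v a * ∑ r, sgn r * A a r * A b r := by
    simp only [mul_sum, sum_mul]
    rw [sum_comm]
    exact sum_congr rfl fun _ _ => sum_congr rfl fun _ _ => by ring
  rw [hswap, ← sum_eta_mul]
  simp only [sum_mul _ _ (A b m), mul_sum _ _ (A b l), sum_mul _ _ (∑ r, sgn r * A r l * A r m),
    mul_sum _ (fun a => v a * _) (eta l m), mul_sum _ _ (1 / 2 : ℝ), sum_mul _ _ (eta l m),
    sum_mul _ _ (∑ r, ∑ s, sgn r * sgn s * A r s * A r s)]
  rw [← sum_add_distrib, ← sum_sub_distrib, ← sum_sub_distrib, ← sum_add_distrib]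
  refine sum_congr rfl fun a _ => ?_
  unfold SE2
  ring

/-- A covector whose superenergy tensor `2 B_l B_m - η_{lm} B²` vanishes is zero. -/
theorem eq_zero_of_two_mul_self_eq {n : ℕ} (hn : 2 ≤ n) {B : Fin n → ℝ} {q : ℝ}
    (h : ∀ l, 2 * (B l * B l) = sgn l * q) : B = 0 := by
  have h0 := h ⟨0, by omega⟩
  have h1 := h ⟨1, by omega⟩
  simp only [sgn, one_ne_zero, if_true, if_false] at h0 h1
  have hq : q = 0 := by
    nlinarith [mul_self_nonneg (B ⟨0, by omega⟩), mul_self_nonneg (B ⟨1, by omega⟩)]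
  funext l
  simpa [hq] using h l

/-- T_{αβλμ}ℓ^α = 0 iff ℓ_{[τ}A_{μ]ν} = 0, for null ℓ. -/
theorem stmt_18 {n : ℕ} (hn : 2 ≤ n) (A : Fin n → Fin n → ℝ)
    (ℓ : Fin n → ℝ) (hℓ0 : ℓ ≠ 0) (hnull : mSq ℓ = 0) :
    (∀ b l m : Fin n, ∑ a, SE2 A a b l m * ℓ a = 0) ↔
      (∀ t m v : Fin n, lo ℓ t * A m v - lo ℓ m * A t v = 0) := by
  have ho : ((⟨0, by omega⟩ : Fin n) : ℕ) = 0 := rfl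
  set o : Fin n := ⟨0, by omega⟩
  have hc : lo ℓ o ≠ 0 := by
    simp [lo, sgn, ho, time_component_ne_zero hℓ0 hnull ho]
  have hlo : ∑ b, ℓ b * lo ℓ b = 0 := by
    rw [← hnull]
    exact sum_congr rfl fun _ _ => by unfold lo; ring
  simp only [sum_SE2_mul]
  constructor
  · intro h
    have hB : (fun r => ∑ a, ℓ a * A a r) = 0 := by
      refine eq_zero_of_two_mul_self_eq hn
        (q := ∑ r, sgn r * (∑ a, ℓ a * A a r) * (∑ a, ℓ a * A a r)) fun l => ?_
      have hswap : ∑ r, sgn r * (∑ a, ℓ a * A a r) * (∑ a, ℓ a * A a r) =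
          ∑ b, ℓ b * ∑ r, sgn r * (∑ a, ℓ a * A a r) * A b r := by
        simp only [mul_sum _ _ (sgn _ * _), mul_sum _ _ (ℓ _)]
        rw [sum_comm]
        exact sum_congr rfl fun _ _ => sum_congr rfl fun _ _ => by ring
      rw [hswap]
      have hterm : ∀ b, ℓ b * A b l * (2 * ∑ a, ℓ a * A a l) =
          sgn l * (ℓ b * ∑ r, sgn r * (∑ a, ℓ a * A a r) * A b r) + ℓ b * lo ℓ b *
            ((∑ r, sgn r * A r l * A r l)
              - (1/2) * sgn l * ∑ r, ∑ s, sgn r * sgn s * A r s * A r s) := by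
        intro b
        have hb := h b l l
        simp only [eta, if_true] at hb
        linear_combination ℓ b * hb
      have hsum := sum_congr rfl fun b (_ : b ∈ univ) => hterm b
      rw [← sum_mul, sum_add_distrib, ← mul_sum, ← sum_mul, hlo] at hsum
      linear_combination hsum
    have hB' : ∀ r, ∑ a, ℓ a * A a r = 0 := fun r => congrFun hB r
    have hG : ∀ l, ∑ r, sgn r * A r l * A r l =
        sgn l * ((1/2) * ∑ r, ∑ s, sgn r * sgn s * A r s * A r s) := by
      intro l
      have := h o l l
      simp only [hB', eta, if_true, mul_zero, zero_mul, sum_const_zero] at this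
      apply mul_left_cancel₀ hc
      linear_combination -this
    have hS : (1/2) * ∑ r, ∑ s, sgn r * sgn s * A r s * A r s = 0 := by
      have h0 := sum_sgn_mul_self_nonneg hℓ0 hnull (hB' o) ho
      have h1 := sum_sgn_mul_self_nonneg hℓ0 hnull (hB' ⟨1, by omega⟩) ho
      rw [hG] at h0 h1
      generalize (1/2) * ∑ r, ∑ s, sgn r * sgn s * A r s * A r s = S at h0 h1 ⊢
      simp only [sgn, ho, one_ne_zero, if_true, if_false] at h0 h1
      linarith
    intro t m v
    exact wedge_eq_zero_of_null hℓ0 hnull (hB' v) ho (by rw [hG, hS, mul_zero]) t m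
  · intro h
    obtain ⟨c, hA⟩ : ∃ c : Fin n → ℝ, ∀ m v, A m v = lo ℓ m * c v := by
      refine ⟨fun v => A o v / lo ℓ o, fun m v => ?_⟩
      field_simp
      linear_combination h o m v
    have hB : ∀ r, ∑ a, ℓ a * A a r = 0 := by
      intro r
      simp only [hA, ← mul_assoc, ← sum_mul, hlo, zero_mul]
    have hG : ∀ l m, ∑ r, sgn r * A r l * A r m = 0 := by
      intro l m
      have : ∀ r, sgn r * A r l * A r m = ℓ r * lo ℓ r * (c l * c m) := by
        intro r
        simp only [hA, lo]
        linear_combination (sgn r * ℓ r ^ 2 * c l * c m) * sgn_mul_self r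
      simp only [this, ← sum_mul, hlo, zero_mul]
    have hS : ∑ r, ∑ s, sgn r * sgn s * A r s * A r s = 0 := by
      rw [sum_comm]
      refine sum_eq_zero fun s _ => ?_
      rw [← mul_zero (sgn s), ← hG s s, mul_sum]
      exact sum_congr rfl fun _ _ => by ring
    intro b l m
    simp [hB, hG, hS]
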